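/- Let T : ℋⁿ → ℋⁿ be an ℝ-linear map. Then the following are equivalent: (i) there exists a vector q ∈ ℝⁿ with decreasing entries such that λ(T(X)) ≺ q*λ(X) for all X ∈ ℋⁿ; (ii) there exist t ∈ ℝ and an ℝ-linear map D : ℋⁿ → ℋⁿ that is doubly stochastic (D is positive, D(I) = I, and D*(I) = I) such that T = tD. -/

import Mathlib

open Matrix
open scoped ComplexOrder

/-- Sum of the `k` largest entries of `p` (as a supremum of sums over `k`-subsets). -/
noncomputable def sumLargest {n : ℕ} (p : Fin n → ℝ) (k : ℕ) : ℝ :=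
  sSup ((fun A : Finset (Fin n) => ∑ i ∈ A, p i) '' {A : Finset (Fin n) | A.card = k})

/-- `p` is weakly majorized by `q`. -/
def WeakMaj {n : ℕ} (p q : Fin n → ℝ) : Prop :=
  ∀ k : ℕ, 1 ≤ k → k ≤ n → sumLargest p k ≤ sumLargest q k

/-- `p` is majorized by `q`. -/
def Maj {n : ℕ} (p q : Fin n → ℝ) : Prop :=
  WeakMaj p q ∧ ∑ i, p i = ∑ i, q i

/-- `p` has nonnegative entries arranged in decreasing order. -/
def DecrNonneg {n : ℕ} (p : Fin n → ℝ) : Prop :=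
  Antitone p ∧ ∀ i, 0 ≤ p i

/-- The decreasing rearrangement of a vector. -/
noncomputable def decrRearrange {n : ℕ} (p : Fin n → ℝ) : Fin n → ℝ :=
  fun i => p (Tuple.sort p (Fin.rev i))

/-- `x` is the supremum of `S` in the weak-majorization order (w-sup). -/
def IsWSup {n : ℕ} (S : Set (Fin n → ℝ)) (x : Fin n → ℝ) : Prop :=
  DecrNonneg x ∧ (∀ s ∈ S, WeakMaj s x) ∧
    ∀ p : Fin n → ℝ, (∀ i, 0 ≤ p i) → (∀ s ∈ S, WeakMaj s p) → WeakMaj x p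

/-- `x` is the infimum of `Q` in the weak-majorization order (w-inf). -/
def IsWInf {n : ℕ} (Q : Set (Fin n → ℝ)) (x : Fin n → ℝ) : Prop :=
  DecrNonneg x ∧ (∀ q ∈ Q, WeakMaj x q) ∧
    ∀ p : Fin n → ℝ, (∀ i, 0 ≤ p i) → (∀ q ∈ Q, WeakMaj p q) → WeakMaj p x

open Classical in
/-- The vector of eigenvalues of a Hermitian matrix, in decreasing order
(junk value `0` if the matrix is not Hermitian). -/
noncomputable def specVec {n : ℕ} (X : Matrix (Fin n) (Fin n) ℂ) : Fin n → ℝ :=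
  if h : X.IsHermitian then decrRearrange h.eigenvalues else 0

open Classical in
/-- `λ(|X|)`: the absolute values of the eigenvalues of a Hermitian matrix `X`,
in decreasing order. -/
noncomputable def absSpecVec {n : ℕ} (X : Matrix (Fin n) (Fin n) ℂ) : Fin n → ℝ :=
  if h : X.IsHermitian then decrRearrange (fun i => |h.eigenvalues i|) else 0

/-- The Jordan product `X ∘ Y = (XY + YX)/2`. -/
noncomputable def jmul {n : ℕ} (X Y : Matrix (Fin n) (Fin n) ℂ) : Matrix (Fin n) (Fin n) ℂ :=
  (2 : ℂ)⁻¹ • (X * Y + Y * X)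

/-- A nonzero (orthogonal) projection in `ℋⁿ`. -/
def IsProjection {n : ℕ} (P : Matrix (Fin n) (Fin n) ℂ) : Prop :=
  P.IsHermitian ∧ P * P = P ∧ P ≠ 0

/-- An involution in `ℋⁿ`: a Hermitian matrix with `ε² = I`. -/
def IsInvolution {n : ℕ} (ε : Matrix (Fin n) (Fin n) ℂ) : Prop :=
  ε.IsHermitian ∧ ε * ε = 1

/-- A positive map: maps positive semidefinite matrices to positive semidefinite matrices. -/
def PositiveMap {n : ℕ} (T : Matrix (Fin n) (Fin n) ℂ → Matrix (Fin n) (Fin n) ℂ) : Prop :=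
  ∀ X : Matrix (Fin n) (Fin n) ℂ, X.PosSemidef → (T X).PosSemidef

/-- `S` is the adjoint of `T` with respect to the trace inner product on `ℋⁿ`. -/
def IsAdjointOf {n : ℕ} (S T : Matrix (Fin n) (Fin n) ℂ → Matrix (Fin n) (Fin n) ℂ) : Prop :=
  ∀ X Y : Matrix (Fin n) (Fin n) ℂ, X.IsHermitian → Y.IsHermitian →
    Matrix.trace (T X * Y) = Matrix.trace (X * S Y)

/-- `q` is the least vector of `T`: `λ(|T(X)|) ≺_w q * λ(|X|)` for all Hermitian `X`,
and `q ≺_w q'` for any other `q' ∈ (ℝⁿ₊)↓` with the same property. -/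
def IsLeastVector {n : ℕ} (T : Matrix (Fin n) (Fin n) ℂ → Matrix (Fin n) (Fin n) ℂ)
    (q : Fin n → ℝ) : Prop :=
  DecrNonneg q ∧
  (∀ X : Matrix (Fin n) (Fin n) ℂ, X.IsHermitian →
    WeakMaj (absSpecVec (T X)) (q * absSpecVec X)) ∧
  ∀ q' : Fin n → ℝ, DecrNonneg q' →
    (∀ X : Matrix (Fin n) (Fin n) ℂ, X.IsHermitian →
      WeakMaj (absSpecVec (T X)) (q' * absSpecVec X)) → WeakMaj q q'

section Majorization

variable {n : ℕ} {p q : Fin n → ℝ}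

lemma sum_le_sumLargest (p : Fin n → ℝ) (A : Finset (Fin n)) :
    ∑ i ∈ A, p i ≤ sumLargest p A.card :=
  le_csSup (Set.toFinite _).bddAbove ⟨A, rfl, rfl⟩

lemma sumLargest_le {k : ℕ} (hk : k ≤ n) {c : ℝ}
    (h : ∀ A : Finset (Fin n), A.card = k → ∑ i ∈ A, p i ≤ c) : sumLargest p k ≤ c := by
  refine csSup_le (Set.Nonempty.image _ ?_) ?_
  · obtain ⟨A, -, hA⟩ := Finset.exists_subset_card_eq
      (s := (Finset.univ : Finset (Fin n))) (n := k) (by simpa using hk)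
    exact ⟨A, hA⟩
  · rintro _ ⟨A, hA, rfl⟩
    exact h A hA

lemma sumLargest_comp_perm (p : Fin n → ℝ) (σ : Equiv.Perm (Fin n)) {k : ℕ} (hk : k ≤ n) :
    sumLargest (p ∘ σ) k = sumLargest p k := by
  have key (p : Fin n → ℝ) (σ : Equiv.Perm (Fin n)) :
      sumLargest (p ∘ σ) k ≤ sumLargest p k := by
    refine sumLargest_le hk fun A hA => ?_
    have h := sum_le_sumLargest p (A.map σ.toEmbedding)
    simpa [hA] using h
  refine le_antisymm (key p σ) ?_
  simpa [Function.comp_assoc] using key (p ∘ σ) σ⁻¹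

lemma Maj.comp_perm (h : Maj p q) (σ τ : Equiv.Perm (Fin n)) : Maj (p ∘ σ) (q ∘ τ) := by
  refine ⟨fun k hk hkn => ?_, ?_⟩
  · rw [sumLargest_comp_perm p σ hkn, sumLargest_comp_perm q τ hkn]
    exact h.1 k hk hkn
  · simpa [Equiv.sum_comp σ p, Equiv.sum_comp τ q] using h.2

lemma maj_mulVec_of_mem_doublyStochastic {M : Matrix (Fin n) (Fin n) ℝ}
    (hM : M ∈ doublyStochastic ℝ (Fin n)) (p : Fin n → ℝ) : Maj (M *ᵥ p) p := by
  refine ⟨fun k _ hkn => sumLargest_le hkn fun A hA => ?_, ?_⟩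
  · obtain ⟨w, hw, hw1, rfl⟩ := exists_eq_sum_perm_of_mem_doublyStochastic hM
    have hperm (σ : Equiv.Perm (Fin n)) : ∑ i ∈ A, p (σ i) ≤ sumLargest p k := by
      have h := sum_le_sumLargest p (A.map σ.toEmbedding)
      simpa [hA] using h
    calc ∑ i ∈ A, ((∑ σ, w σ • σ.permMatrix ℝ) *ᵥ p) i
        = ∑ σ, w σ * ∑ i ∈ A, p (σ i) := by
          simp only [Matrix.sum_mulVec, Matrix.smul_mulVec, Finset.sum_apply, Pi.smul_apply,
            Matrix.permMatrix_mulVec, smul_eq_mul, Function.comp_apply, Finset.mul_sum]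
          rw [Finset.sum_comm]
      _ ≤ ∑ σ, w σ * sumLargest p k :=
          Finset.sum_le_sum fun σ _ => mul_le_mul_of_nonneg_left (hperm σ) (hw σ)
      _ = sumLargest p k := by rw [← Finset.sum_mul, hw1, one_mul]
  · simp only [Matrix.mulVec, dotProduct]
    rw [Finset.sum_comm]
    simp [← Finset.sum_mul, sum_col_of_mem_doublyStochastic hM]

lemma WeakMaj.le_of_le (h : WeakMaj p q) {c : ℝ} (hq : ∀ i, q i ≤ c) (i : Fin n) :
    p i ≤ c := by
  have hn : 1 ≤ n := by have := i.isLt; omega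
  calc p i ≤ sumLargest p 1 := by simpa using sum_le_sumLargest p {i}
    _ ≤ sumLargest q 1 := h 1 le_rfl hn
    _ ≤ c := sumLargest_le hn fun A hA => by
      obtain ⟨j, rfl⟩ := Finset.card_eq_one.mp hA
      simpa using hq j

lemma Maj.eq_const {c : ℝ} (h : Maj p (fun _ => c)) (i : Fin n) : p i = c :=
  (Finset.sum_eq_sum_iff_of_le fun i _ => h.1.le_of_le (fun _ => le_rfl) i).mp h.2 i
    (Finset.mem_univ i)

end Majorization

section Spectrum

variable {n : ℕ} {X : Matrix (Fin n) (Fin n) ℂ}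

lemma exists_specVec_eq_comp_perm (hX : X.IsHermitian) :
    ∃ σ : Equiv.Perm (Fin n), specVec X = hX.eigenvalues ∘ σ :=
  ⟨Fin.revPerm.trans (Tuple.sort hX.eigenvalues), by
    rw [specVec, dif_pos hX]; rfl⟩

lemma antitone_decrRearrange (p : Fin n → ℝ) : Antitone (decrRearrange p) :=
  fun _ _ hij => Tuple.monotone_sort p (Fin.rev_le_rev.mpr hij)

lemma sum_specVec (hX : X.IsHermitian) : ((∑ i, specVec X i : ℝ) : ℂ) = X.trace := by
  obtain ⟨σ, hσ⟩ := exists_specVec_eq_comp_perm hX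
  rw [hX.trace_eq_sum_eigenvalues, hσ]
  simp [Equiv.sum_comp σ fun i => (hX.eigenvalues i : ℂ)]

lemma isHermitian_diagonal_ofReal (d : Fin n → ℝ) :
    (diagonal fun i => (d i : ℂ)).IsHermitian :=
  isHermitian_diagonal_of_self_adjoint _ <| funext fun i => Complex.conj_ofReal (d i)

lemma specVec_diagonal_comp_perm {d : Fin n → ℝ} (hd : Antitone d) (σ : Equiv.Perm (Fin n)) :
    specVec (diagonal fun i => (d (σ i) : ℂ)) = d := by
  have h : (diagonal fun i => (d (σ i) : ℂ)).IsHermitian := isHermitian_diagonal_ofReal (d ∘ σ)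
  have hroots := h.roots_charpoly_eq_eigenvalues
  rw [charpoly_diagonal, Polynomial.roots_prod _ _
    (by simp [Finset.prod_ne_zero_iff, Polynomial.X_sub_C_ne_zero])] at hroots
  have heig : Multiset.map h.eigenvalues Finset.univ.val = Multiset.map d Finset.univ.val := by
    have := congrArg (Multiset.map Complex.re) hroots
    simp only [Polynomial.roots_X_sub_C, Multiset.bind_singleton, Multiset.map_map] at this
    have hσ : Multiset.map (d ∘ σ) Finset.univ.val = Multiset.map d Finset.univ.val := by
      rw [← Multiset.map_map, Multiset.map_univ_val_equiv]
    rw [← hσ]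
    exact this.symm
  obtain ⟨τ, hτ⟩ := exists_specVec_eq_comp_perm h
  have hanti : Antitone (specVec (diagonal fun i => (d (σ i) : ℂ))) := by
    rw [specVec, dif_pos h]
    exact antitone_decrRearrange _
  have hperm : Multiset.map (specVec (diagonal fun i => (d (σ i) : ℂ))) Finset.univ.val
      = Multiset.map d Finset.univ.val := by
    rw [← heig]
    refine (congrArg (fun f => Multiset.map f Finset.univ.val) hτ).trans ?_
    rw [← Multiset.map_map, Multiset.map_univ_val_equiv]
  rw [Fin.univ_val_map, Fin.univ_val_map, Multiset.coe_eq_coe] at hperm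
  exact List.ofFn_injective
    (hperm.eq_of_pairwise' hanti.sortedGE_ofFn.pairwise hd.sortedGE_ofFn.pairwise)

lemma exists_spectral_projections (hX : X.IsHermitian) :
    ∃ P : Fin n → Matrix (Fin n) (Fin n) ℂ, (∀ i, (P i).PosSemidef) ∧ ∑ i, P i = 1 ∧
      (∀ i, (P i).trace = 1) ∧ X = ∑ i, hX.eigenvalues i • P i ∧
      (∀ i, (X * P i).trace = hX.eigenvalues i) ∧
      ∀ A : Matrix (Fin n) (Fin n) ℂ, A.PosSemidef → ∀ i, 0 ≤ (A * P i).trace.re := by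
  let U : Matrix (Fin n) (Fin n) ℂ := (hX.eigenvectorUnitary : Matrix (Fin n) (Fin n) ℂ)
  have hUU : Uᴴ * U = 1 := Unitary.coe_star_mul_self hX.eigenvectorUnitary
  have hUU' : U * Uᴴ = 1 := Unitary.coe_mul_star_self hX.eigenvectorUnitary
  have htr (A : Matrix (Fin n) (Fin n) ℂ) (i : Fin n) :
      (A * (U * single i i 1 * Uᴴ)).trace = (Uᴴ * A * U) i i := by
    rw [← mul_assoc, trace_mul_comm, ← mul_assoc, ← mul_assoc, trace_mul_single]
    simp
  have hspec : X = U * diagonal (fun i => (hX.eigenvalues i : ℂ)) * Uᴴ := hX.spectral_theorem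
  refine ⟨fun i => U * single i i 1 * Uᴴ, fun i => ?_, ?_, fun i => ?_, ?_, fun i => ?_,
    fun A hA i => ?_⟩
  · refine PosSemidef.mul_mul_conjTranspose_same ?_ U
    rw [← diagonal_single]
    exact PosSemidef.diagonal (Pi.single_nonneg.mpr zero_le_one)
  · rw [← Finset.sum_mul, ← Finset.mul_sum, sum_single_eq_diagonal]
    simp [hUU']
  · rw [trace_mul_comm, ← mul_assoc, hUU, one_mul, trace_single_eq_same]
  · have hdiag : diagonal (fun i => (hX.eigenvalues i : ℂ))
        = ∑ i, hX.eigenvalues i • single i i (1 : ℂ) := by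
      rw [← sum_single_eq_diagonal]
      simp [smul_single]
    conv_lhs => rw [hspec, hdiag]
    simp only [Finset.mul_sum, Finset.sum_mul, mul_smul_comm, smul_mul_assoc]
  · have hdiag : Uᴴ * X * U = diagonal fun i => (hX.eigenvalues i : ℂ) := by
      conv_lhs => rw [hspec, ← mul_assoc, ← mul_assoc, hUU, one_mul, mul_assoc, hUU, mul_one]
    rw [htr, hdiag, diagonal_apply_eq]
  · rw [htr]
    exact (Complex.le_def.mp (hA.conjTranspose_mul_mul_same U).diag_nonneg).1

lemma eigenvalues_eq_of_specVec_eq (hX : X.IsHermitian) {c : ℝ} (h : ∀ i, specVec X i = c)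
    (i : Fin n) : hX.eigenvalues i = c := by
  obtain ⟨σ, hσ⟩ := exists_specVec_eq_comp_perm hX
  simpa [hσ] using h (σ.symm i)

lemma eq_smul_one_of_specVec_eq (hX : X.IsHermitian) {c : ℝ} (h : ∀ i, specVec X i = c) :
    X = c • (1 : Matrix (Fin n) (Fin n) ℂ) := by
  obtain ⟨P, -, hP1, -, hXP, -, -⟩ := exists_spectral_projections hX
  rw [hXP, ← hP1, Finset.smul_sum]
  simp only [eigenvalues_eq_of_specVec_eq hX h]

lemma posSemidef_neg_iff_specVec_nonpos (hX : X.IsHermitian) :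
    (-X).PosSemidef ↔ ∀ i, specVec X i ≤ 0 := by
  obtain ⟨σ, hσ⟩ := exists_specVec_eq_comp_perm hX
  obtain ⟨P, hP, -, -, hXP, htr, hpos⟩ := exists_spectral_projections hX
  rw [hσ]
  refine ⟨fun h i => ?_, fun h => ?_⟩
  · have := hpos _ h (σ i)
    rw [neg_mul, trace_neg, htr] at this
    simpa using this
  · rw [hXP, ← Finset.sum_neg_distrib]
    refine posSemidef_sum _ fun i _ => ?_
    rw [← neg_smul]
    exact (hP i).smul (neg_nonneg.mpr (by simpa using h (σ.symm i)))

end Spectrum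

section LinearMaps

variable {n : ℕ} {T D D' : Matrix (Fin n) (Fin n) ℂ → Matrix (Fin n) (Fin n) ℂ}

lemma maj_specVec_smul_of_doublyStochastic (hDlin : IsLinearMap ℝ D) (hD : PositiveMap D)
    (hadj : IsAdjointOf D' D) (hD1 : D 1 = 1) (hD'1 : D' 1 = 1) (t : ℝ)
    {X Y : Matrix (Fin n) (Fin n) ℂ} (hX : X.IsHermitian) (hY : Y.IsHermitian)
    (hYX : Y = t • D X) : Maj (specVec Y) (t • specVec X) := by
  obtain ⟨P, hP, hP1, hPtr, hXP, -, -⟩ := exists_spectral_projections hX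
  obtain ⟨Q, -, hQ1, hQtr, -, hYQ, hQpos⟩ := exists_spectral_projections hY
  obtain ⟨σ, hσ⟩ := exists_specVec_eq_comp_perm hY
  obtain ⟨τ, hτ⟩ := exists_specVec_eq_comp_perm hX
  let L := hDlin.mk' D
  have hL (Z) : D Z = L Z := rfl
  let S : Matrix (Fin n) (Fin n) ℝ := Matrix.of fun i j => (D (P j) * Q i).trace.re
  have hS : S ∈ doublyStochastic ℝ (Fin n) := by
    refine mem_doublyStochastic_iff_sum.mpr
      ⟨fun i j => hQpos _ (hD _ (hP j)) i, fun i => ?_, fun j => ?_⟩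
    · simp only [S, of_apply]
      rw [← Complex.re_sum, ← trace_sum, ← Finset.sum_mul]
      simp only [hL]
      rw [← map_sum, hP1, ← hL, hD1, one_mul, hQtr, Complex.one_re]
    · simp only [S, of_apply]
      rw [← Complex.re_sum, ← trace_sum, ← Finset.mul_sum, hQ1,
        hadj _ _ (hP j).isHermitian isHermitian_one, hD'1, mul_one, hPtr, Complex.one_re]
  have hmul : hY.eigenvalues = S *ᵥ (t • hX.eigenvalues) := by
    funext i
    have h : hY.eigenvalues i = (Y * Q i).trace.re := by rw [hYQ, Complex.ofReal_re]
    have hDX : D X = ∑ j, hX.eigenvalues j • D (P j) := by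
      conv_lhs => rw [hXP]
      simp only [hL, map_sum, map_smul]
    rw [h, hYX, hDX]
    simp only [S, mulVec, dotProduct, of_apply, Finset.smul_sum, Finset.sum_mul, trace_sum,
      Complex.re_sum, smul_mul_assoc, trace_smul, Complex.real_smul, Complex.re_ofReal_mul,
      Pi.smul_apply, smul_eq_mul]
    exact Finset.sum_congr rfl fun j _ => by ring
  rw [hσ, hτ, hmul]
  exact (maj_mulVec_of_mem_doublyStochastic hS _).comp_perm σ τ

/-- The trace adjoint of the complex-linear extension of the restriction of `D` to Hermitian
matrices. -/
noncomputable def traceAdjoint (D : Matrix (Fin n) (Fin n) ℂ → Matrix (Fin n) (Fin n) ℂ)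
    (Y : Matrix (Fin n) (Fin n) ℂ) : Matrix (Fin n) (Fin n) ℂ :=
  Matrix.of fun i j =>
    (D (single j i 1 + single i j 1) * Y).trace / 2 +
      (D (Complex.I • (single j i 1 - single i j 1)) * Y).trace / (2 * Complex.I)

lemma isLinearMap_traceAdjoint (D : Matrix (Fin n) (Fin n) ℂ → Matrix (Fin n) (Fin n) ℂ) :
    IsLinearMap ℝ (traceAdjoint D) := by
  constructor
  · intro Y Z
    ext i j
    simp only [traceAdjoint, of_apply, Matrix.add_apply, mul_add, trace_add]
    ring
  · intro c Y
    ext i j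
    simp only [traceAdjoint, of_apply, Matrix.smul_apply, mul_smul_comm, trace_smul, Complex.real_smul]
    ring

lemma isHermitian_single_add (i j : Fin n) :
    (single j i (1 : ℂ) + single i j 1).IsHermitian := by
  rw [IsHermitian, conjTranspose_add, conjTranspose_single, conjTranspose_single, star_one,
    add_comm]

lemma isHermitian_I_smul_single_sub (i j : Fin n) :
    (Complex.I • (single j i (1 : ℂ) - single i j 1)).IsHermitian := by
  rw [IsHermitian, conjTranspose_smul, conjTranspose_sub, conjTranspose_single,
    conjTranspose_single, star_one, Complex.star_def, Complex.conj_I, neg_smul, ← smul_neg,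
    neg_sub]

lemma star_trace_mul {A B : Matrix (Fin n) (Fin n) ℂ} (hA : A.IsHermitian)
    (hB : B.IsHermitian) : star (A * B).trace = (A * B).trace := by
  rw [← trace_conjTranspose, conjTranspose_mul, hA.eq, hB.eq, trace_mul_comm]

lemma isHermitian_traceAdjoint (hDlin : IsLinearMap ℝ D)
    (hD : ∀ X : Matrix (Fin n) (Fin n) ℂ, X.IsHermitian → (D X).IsHermitian)
    {Y : Matrix (Fin n) (Fin n) ℂ} (hY : Y.IsHermitian) : (traceAdjoint D Y).IsHermitian := by
  ext i j
  have h1 := star_trace_mul (hD _ (isHermitian_single_add j i)) hY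
  have h2 := star_trace_mul (hD _ (isHermitian_I_smul_single_sub j i)) hY
  have h3 : D (Complex.I • (single j i 1 - single i j 1))
      = -D (Complex.I • (single i j 1 - single j i 1)) := by
    rw [← hDlin.map_neg, ← smul_neg, neg_sub]
  simp only [traceAdjoint, conjTranspose_apply, of_apply, star_add, star_div₀, h1, h2, h3]
  rw [add_comm (single i j (1 : ℂ))]
  simp [neg_div, div_neg]

lemma sum_sum_eq_of_add_swap_eq {ι M : Type*} [Fintype ι] [AddCommGroup M] [Module ℝ M]
    {f g : ι → ι → M} (h : ∀ i j, f i j + f j i = g i j + g j i) :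
    ∑ i, ∑ j, f i j = ∑ i, ∑ j, g i j := by
  have hdouble (f : ι → ι → M) : (2 : ℝ) • ∑ i, ∑ j, f i j = ∑ i, ∑ j, (f i j + f j i) := by
    simp only [Finset.sum_add_distrib]
    rw [Finset.sum_comm (f := fun i j => f j i), two_smul]
  refine smul_right_injective M (two_ne_zero (α := ℝ)) ?_
  simp only [hdouble, h]

lemma Matrix.IsHermitian.eq_sum_smul_single {X : Matrix (Fin n) (Fin n) ℂ} (hX : X.IsHermitian) :
    X = ∑ i, ∑ j, (((X i j).re / 2) • (single i j (1 : ℂ) + single j i 1) +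
      ((X i j).im / 2) • (Complex.I • (single i j (1 : ℂ) - single j i 1))) := by
  conv_lhs => rw [matrix_eq_sum_single X]
  refine sum_sum_eq_of_add_swap_eq fun i j => ?_
  have hz (i j : Fin n) : single i j (X i j) = X i j • single i j (1 : ℂ) := by
    simp [smul_single]
  have hre : (X j i).re = (X i j).re := by rw [← hX.apply i j]; simp
  have him : (X j i).im = -(X i j).im := by rw [← hX.apply i j]; simp
  rw [hz i j, hz j i, ← Complex.re_add_im (X i j), ← Complex.re_add_im (X j i), hre, him]
  simp only [← Complex.coe_smul, Complex.add_re, Complex.add_im, Complex.ofReal_re,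
    Complex.ofReal_im, Complex.re_ofReal_mul, Complex.im_ofReal_mul, Complex.I_re, Complex.I_im]
  push_cast
  module

lemma isAdjointOf_traceAdjoint (hDlin : IsLinearMap ℝ D) :
    IsAdjointOf (traceAdjoint D) D := by
  intro X Y hX _
  let L := hDlin.mk' D
  have hL (Z) : D Z = L Z := rfl
  have hDX : (D X * Y).trace = ∑ i, ∑ j,
      (((X i j).re / 2 : ℝ) * (D (single i j 1 + single j i 1) * Y).trace +
        ((X i j).im / 2 : ℝ) * (D (Complex.I • (single i j 1 - single j i 1)) * Y).trace) := by
    conv_lhs => rw [hX.eq_sum_smul_single]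
    simp only [hL, map_sum, map_add, map_smul, Finset.sum_mul, add_mul, smul_mul_assoc,
      trace_sum, trace_add, trace_smul, Complex.real_smul]
  have hXD : (X * traceAdjoint D Y).trace = ∑ i, ∑ j, X i j * traceAdjoint D Y j i := by
    simp only [trace, diag_apply, mul_apply]
  rw [hDX, hXD]
  refine sum_sum_eq_of_add_swap_eq fun i j => ?_
  have hre : (X j i).re = (X i j).re := by rw [← hX.apply i j]; simp
  have him : (X j i).im = -(X i j).im := by rw [← hX.apply i j]; simp
  have hI : D (Complex.I • (single j i 1 - single i j 1))
      = -D (Complex.I • (single i j 1 - single j i 1)) := by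
    rw [← hDlin.map_neg, ← smul_neg, neg_sub]
  rw [← Complex.re_add_im (X i j), ← Complex.re_add_im (X j i)]
  simp only [traceAdjoint, of_apply, hI, hre, him, add_comm (single j i (1 : ℂ)), neg_mul,
    trace_neg, Complex.add_re, Complex.add_im, Complex.ofReal_re, Complex.ofReal_im,
    Complex.re_ofReal_mul, Complex.im_ofReal_mul, Complex.I_re, Complex.I_im]
  push_cast
  field_simp
  ring

lemma traceAdjoint_one
    (htr : ∀ X : Matrix (Fin n) (Fin n) ℂ, X.IsHermitian → (D X).trace = X.trace) :
    traceAdjoint D 1 = 1 := by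
  ext i j
  simp only [traceAdjoint, of_apply, mul_one, htr _ (isHermitian_single_add i j),
    htr _ (isHermitian_I_smul_single_sub i j), trace_add, trace_smul, trace_sub]
  rcases eq_or_ne i j with rfl | hij
  · simp
  · simp [hij, hij.symm, trace_single_eq_of_ne]

lemma exists_eq_smul_of_maj (hTlin : IsLinearMap ℝ T)
    (hT : ∀ X : Matrix (Fin n) (Fin n) ℂ, X.IsHermitian → (T X).IsHermitian)
    {q : Fin n → ℝ} (hq : Antitone q)
    (h : ∀ X : Matrix (Fin n) (Fin n) ℂ, X.IsHermitian → Maj (specVec (T X)) (q * specVec X)) :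
    ∃ t : ℝ, ∀ i, q i = t := by
  rcases n with _ | n
  · exact ⟨0, fun i => i.elim0⟩
  have htr {d : Fin (n + 1) → ℝ} (hd : Antitone d) (σ : Equiv.Perm (Fin (n + 1))) :
      ((∑ i, q i * d i : ℝ) : ℂ) = (T (diagonal fun i => (d (σ i) : ℂ))).trace := by
    have hX : (diagonal fun i => (d (σ i) : ℂ)).IsHermitian :=
      isHermitian_diagonal_ofReal (d ∘ σ)
    rw [← sum_specVec (hT _ hX), (h _ hX).2]
    refine congrArg _ (Finset.sum_congr rfl fun i _ => ?_)
    rw [Pi.mul_apply, specVec_diagonal_comp_perm hd σ]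
  have hfirst : Antitone (Pi.single 0 1 : Fin (n + 1) → ℝ) := by
    intro i j hij
    rcases eq_or_ne j 0 with rfl | hj
    · rw [Fin.le_zero_iff.mp hij]
    · rw [Pi.single_eq_of_ne hj]
      exact (Pi.single_nonneg.mpr zero_le_one : (0 : Fin (n + 1) → ℝ) ≤ _) i
  have hlast : Antitone (-Pi.single (Fin.last n) 1 : Fin (n + 1) → ℝ) := by
    intro i j hij
    simp only [Pi.neg_apply, neg_le_neg_iff]
    rcases eq_or_ne i (Fin.last n) with rfl | hi
    · rw [Fin.last_le_iff.mp hij]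
    · rw [Pi.single_eq_of_ne hi]
      exact (Pi.single_nonneg.mpr zero_le_one : (0 : Fin (n + 1) → ℝ) ≤ _) j
  have h1 := htr hfirst 1
  have h2 := htr hlast (Equiv.swap 0 (Fin.last n))
  have hneg : (diagonal fun i =>
      (((-Pi.single (Fin.last n) 1 : Fin (n + 1) → ℝ) (Equiv.swap 0 (Fin.last n) i) : ℝ) : ℂ))
      = -diagonal fun i => ((Pi.single 0 1 : Fin (n + 1) → ℝ) i : ℂ) := by
    rw [diagonal_neg]
    congr 1
    funext i
    simp [Pi.single_apply, Equiv.swap_apply_eq_iff]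
  rw [hneg, hTlin.map_neg, trace_neg] at h2
  simp only [Equiv.Perm.coe_one, id_eq] at h1
  rw [← h1, ← Complex.ofReal_neg, Complex.ofReal_inj] at h2
  simp [Pi.single_apply] at h2
  refine ⟨q 0, fun i => le_antisymm (hq (Fin.zero_le i)) ?_⟩
  rw [← h2]
  exact hq (Fin.le_last i)

lemma posSemidef_inv_smul_of_maj (hTlin : IsLinearMap ℝ T)
    (hT : ∀ X : Matrix (Fin n) (Fin n) ℂ, X.IsHermitian → (T X).IsHermitian) {t : ℝ}
    (h : ∀ X : Matrix (Fin n) (Fin n) ℂ, X.IsHermitian → Maj (specVec (T X)) (t • specVec X))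
    {X : Matrix (Fin n) (Fin n) ℂ} (hX : X.PosSemidef) : (t⁻¹ • T X).PosSemidef := by
  have hXH := hX.isHermitian
  have hnegX : ∀ i, specVec (-X) i ≤ 0 :=
    (posSemidef_neg_iff_specVec_nonpos hXH.neg).mp (by rwa [neg_neg])
  have key {Z : Matrix (Fin n) (Fin n) ℂ} (hZ : Z.IsHermitian)
      (hle : ∀ i, t * specVec Z i ≤ 0) : (-T Z).PosSemidef :=
    (posSemidef_neg_iff_specVec_nonpos (hT _ hZ)).mpr ((h Z hZ).1.le_of_le hle)
  rcases le_total 0 t with ht | ht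
  · have := key hXH.neg fun i => mul_nonpos_of_nonneg_of_nonpos ht (hnegX i)
    rw [hTlin.map_neg, neg_neg] at this
    exact this.smul (inv_nonneg.mpr ht)
  · have hpos (i : Fin n) : 0 ≤ specVec X i := by
      obtain ⟨σ, hσ⟩ := exists_specVec_eq_comp_perm hXH
      rw [hσ]
      exact hX.eigenvalues_nonneg (σ i)
    have := (key hXH fun i => mul_nonpos_of_nonpos_of_nonneg ht (hpos i)).smul
      (neg_nonneg.mpr (inv_nonpos.mpr ht))
    rwa [smul_neg, neg_smul, neg_neg] at this

end LinearMaps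

theorem majorization_iff_multiple_of_doubly_stochastic (n : ℕ) (T : Matrix (Fin n) (Fin n) ℂ → Matrix (Fin n) (Fin n) ℂ)
    (hTlin : IsLinearMap ℝ T)
    (hT : ∀ X : Matrix (Fin n) (Fin n) ℂ, X.IsHermitian → (T X).IsHermitian) :
    (∃ q : Fin n → ℝ, Antitone q ∧
      ∀ X : Matrix (Fin n) (Fin n) ℂ, X.IsHermitian → Maj (specVec (T X)) (q * specVec X)) ↔
    (∃ (t : ℝ) (D D' : Matrix (Fin n) (Fin n) ℂ → Matrix (Fin n) (Fin n) ℂ), IsLinearMap ℝ D ∧ IsLinearMap ℝ D' ∧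
      PositiveMap D ∧ IsAdjointOf D' D ∧
      (∀ X : Matrix (Fin n) (Fin n) ℂ, X.IsHermitian → (D' X).IsHermitian) ∧
      D 1 = 1 ∧ D' 1 = 1 ∧
      ∀ X : Matrix (Fin n) (Fin n) ℂ, X.IsHermitian → T X = t • D X) := by
  constructor
  · rintro ⟨q, hq, h⟩
    obtain ⟨t, ht⟩ := exists_eq_smul_of_maj hTlin hT hq h
    have hmaj (X : Matrix (Fin n) (Fin n) ℂ) (hX : X.IsHermitian) :
        Maj (specVec (T X)) (t • specVec X) := by
      have hqt : q * specVec X = t • specVec X := by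
        funext i
        simp [ht]
      rw [← hqt]
      exact h X hX
    rcases eq_or_ne t 0 with rfl | ht0
    · refine ⟨0, id, id, ⟨fun _ _ => rfl, fun _ _ => rfl⟩, ⟨fun _ _ => rfl, fun _ _ => rfl⟩,
        fun _ hX => hX, fun _ _ _ _ => rfl, fun _ hX => hX, rfl, rfl, fun X hX => ?_⟩
      have := hmaj X hX
      rw [zero_smul] at this
      rw [eq_smul_one_of_specVec_eq (hT X hX) (c := 0) this.eq_const, zero_smul, zero_smul]
    · let D : Matrix (Fin n) (Fin n) ℂ → Matrix (Fin n) (Fin n) ℂ := fun X => t⁻¹ • T X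
      have hDlin : IsLinearMap ℝ D :=
        ⟨fun X Y => by simp only [D, hTlin.map_add, smul_add],
          fun c X => by simp only [D, hTlin.map_smul, smul_comm c]⟩
      have hDH (X : Matrix (Fin n) (Fin n) ℂ) (hX : X.IsHermitian) : (D X).IsHermitian :=
        (IsSelfAdjoint.all t⁻¹).smul (hT X hX)
      have hDtr (X : Matrix (Fin n) (Fin n) ℂ) (hX : X.IsHermitian) :
          (D X).trace = X.trace := by
        simp only [D]
        rw [trace_smul, ← sum_specVec (hT X hX), (hmaj X hX).2, ← sum_specVec hX]
        simp only [Pi.smul_apply, smul_eq_mul, ← Finset.mul_sum, Complex.real_smul]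
        rw [← Complex.ofReal_mul, inv_mul_cancel_left₀ ht0]
      refine ⟨t, D, traceAdjoint D, hDlin, isLinearMap_traceAdjoint D,
        fun X hX => posSemidef_inv_smul_of_maj hTlin hT hmaj hX,
        isAdjointOf_traceAdjoint hDlin, fun X hX => isHermitian_traceAdjoint hDlin hDH hX, ?_,
        traceAdjoint_one hDtr, fun X _ => (smul_inv_smul₀ ht0 (T X)).symm⟩
      have h1 : specVec (1 : Matrix (Fin n) (Fin n) ℂ) = fun _ => 1 := by
        simpa using specVec_diagonal_comp_perm (n := n) (d := fun _ => 1) antitone_const 1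
      have hT1 := hmaj 1 isHermitian_one
      rw [h1] at hT1
      have hT1' : Maj (specVec (T 1)) fun _ => t := by
        convert hT1 using 1
        funext i
        simp
      simp only [D]
      rw [eq_smul_one_of_specVec_eq (hT 1 isHermitian_one) hT1'.eq_const, inv_smul_smul₀ ht0]
  · rintro ⟨t, D, D', hDlin, -, hD, hadj, -, hD1, hD'1, hTD⟩
    exact ⟨fun _ => t, antitone_const, fun X hX =>
      maj_specVec_smul_of_doublyStochastic hDlin hD hadj hD1 hD'1 t hX (hT X hX) (hTD X hX)⟩
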